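/- Let (G,·) and (H,∘) be loops that are isotopic under a triple (A,B,C) of bijections, and suppose the pair obeys the T condition (i.e. A = B, and either J'_ρ = C⁻¹J_ρB = A⁻¹J_ρC or J'_λ = C⁻¹J_λA = B⁻¹J_λC). Then (G,·) is a weak inverse property loop if and only if (H,∘) is a weak inverse property loop. -/

import Mathlib

/-- A loop: a set with binary operation, two-sided identity, and bijective translations. -/
structure LoopStr (G : Type*) where
  mul : G → G → G
  one : G
  one_mul : ∀ a, mul one a = a
  mul_one : ∀ a, mul a one = a
  left_bij : ∀ a, Function.Bijective fun x => mul a x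
  right_bij : ∀ a, Function.Bijective fun x => mul x a

/-- The weak inverse property: `x·y·z = e` implies `x·(y·z) = e`. -/
def LoopStr.WIP {G : Type*} (L : LoopStr G) : Prop :=
  ∀ x y z, L.mul (L.mul x y) z = L.one → L.mul x (L.mul y z) = L.one

theorem LoopStr.wip_iff_rho {G : Type*} (L : LoopStr G) (ρ : G → G)
    (hρ : ∀ x, L.mul x (ρ x) = L.one) :
    L.WIP ↔ ∀ x y, L.mul y (ρ (L.mul x y)) = ρ x := by
  constructor
  · intro h x y
    exact (L.left_bij x).1 ((h x y _ (hρ _)).trans (hρ x).symm)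
  · intro h x y z hz
    have e : z = ρ (L.mul x y) := (L.left_bij (L.mul x y)).1 (hz.trans (hρ _).symm)
    rw [e, h, hρ]

theorem LoopStr.wip_iff_lam {G : Type*} (L : LoopStr G) (lam : G → G)
    (hlam : ∀ x, L.mul (lam x) x = L.one) :
    L.WIP ↔ ∀ y z, L.mul (lam (L.mul y z)) y = lam z := by
  constructor
  · intro h y z
    obtain ⟨w, hw⟩ := (L.left_bij (L.mul (lam (L.mul y z)) y)).2 L.one
    have hw : L.mul (L.mul (lam (L.mul y z)) y) w = L.one := hw
    have e1 : L.mul y w = L.mul y z :=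
      (L.left_bij (lam (L.mul y z))).1 ((h _ _ _ hw).trans (hlam _).symm)
    have e2 : w = z := (L.left_bij y).1 e1
    rw [e2] at hw
    exact (L.right_bij z).1 (hw.trans (hlam z).symm)
  · intro h x y z hz
    have e : L.mul x y = lam z := (L.right_bij z).1 (hz.trans (hlam _).symm)
    have e2 : x = lam (L.mul y z) := (L.right_bij y).1 (e.trans (h y z).symm)
    rw [e2, hlam]

/-- If loops `(G,·)` and `(H,∘)` are isotopic under a triple of bijections
`(A,B,C)` obeying the `𝒯` condition (`A = B`, and `J'ρ = C⁻¹JρB = A⁻¹JρC` or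
`J'λ = C⁻¹JλA = B⁻¹JλC`), then `G` is a WIPL iff `H` is a WIPL.
(Maps act on the right and compose left to right, so e.g. `J'ρ = C⁻¹JρB` reads
`ρ' h = B (ρ (C.symm h))`.) -/
theorem stmt_0 {G H : Type*} (L : LoopStr G) (M : LoopStr H)
    (ρ lam : G → G) (ρ' lam' : H → H)
    (hρ : ∀ x, L.mul x (ρ x) = L.one)
    (hlam : ∀ x, L.mul (lam x) x = L.one)
    (hρ' : ∀ x, M.mul x (ρ' x) = M.one)
    (hlam' : ∀ x, M.mul (lam' x) x = M.one)
    (A B C : G ≃ H)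
    (hiso : ∀ x y, M.mul (A x) (B y) = C (L.mul x y))
    (hT1 : A = B)
    (hT23 : ((∀ h, ρ' h = B (ρ (C.symm h))) ∧ (∀ h, ρ' h = C (ρ (A.symm h)))) ∨
            ((∀ h, lam' h = A (lam (C.symm h))) ∧ (∀ h, lam' h = C (lam (B.symm h))))) :
    L.WIP ↔ M.WIP := by
  subst hT1
  rcases hT23 with ⟨h1, h2⟩ | ⟨h1, h2⟩
  · rw [L.wip_iff_rho ρ hρ, M.wip_iff_rho ρ' hρ', A.forall_congr_left]
    refine forall_congr' fun x => ?_
    rw [A.forall_congr_left]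
    refine forall_congr' fun y => ?_
    have e := hiso (A.symm x) (A.symm y)
    have e' := hiso (A.symm y) (ρ (L.mul (A.symm x) (A.symm y)))
    simp only [Equiv.apply_symm_apply] at e e'
    rw [h2 x, e, h1, Equiv.symm_apply_apply, e', C.apply_eq_iff_eq]
  · rw [L.wip_iff_lam lam hlam, M.wip_iff_lam lam' hlam', A.forall_congr_left]
    refine forall_congr' fun x => ?_
    rw [A.forall_congr_left]
    refine forall_congr' fun y => ?_
    have e := hiso (A.symm x) (A.symm y)
    have e' := hiso (lam (L.mul (A.symm x) (A.symm y))) (A.symm x)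
    simp only [Equiv.apply_symm_apply] at e e'
    rw [h2 y, e, h1, Equiv.symm_apply_apply, e', C.apply_eq_iff_eq]
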